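/- arXiv:0710.2627 — 3 statements merged into one kernel-verified Lean document; each statement's English description precedes it below -/
import Mathlib

section
/- Let n ≥ 1 and let A and B be invertible symmetric n×n complex matrices such that all roots of the characteristic equation det(A − λB) = 0 are pairwise distinct. Then the projective quadrics {x : xᵀAx = 0} and {x : xᵀBx = 0} are transversal: for every nonzero vector x ∈ ℂⁿ satisfying xᵀAx = 0 and xᵀBx = 0, the gradient vectors Ax and Bx are linearly independent over ℂ. -/
open Matrix

/-- If the `k`-th row and the `k`-th column of `N` are divisible by `t` and the diagonal entry
`N k k` vanishes, then `t ^ 2` divides `det N`. -/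
theorem sq_dvd_det_of_dvd_row_col {R ι : Type*} [CommRing R] [Fintype ι] [DecidableEq ι]
    (N : Matrix ι ι R) (t : R) (k : ι) (hkk : N k k = 0)
    (hrow : ∀ j, t ∣ N k j) (hcol : ∀ i, t ∣ N i k) : t ^ 2 ∣ N.det := by
  choose r hr using hrow
  choose c hc using hcol
  have hN : N = N.updateRow k (t • Function.update r k 0) := by
    ext i j
    by_cases hi : i = k
    · subst hi
      by_cases hj : j = i
      · subst hj; simp [hkk]
      · simp [Function.update_of_ne hj, hr j]
    · simp [Matrix.updateRow_ne hi]
  set N' := N.updateRow k (Function.update r k 0) with hN'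
  have hN'' : N' = N'.updateCol k (t • Function.update c k 0) := by
    ext i j
    by_cases hj : j = k
    · subst hj
      by_cases hi : i = j
      · subst hi; simp [hN']
      · simp [hN', Function.update_of_ne hi, Matrix.updateRow_ne hi, hc i]
    · simp [Matrix.updateCol_ne hj]
  rw [hN, Matrix.det_updateRow_smul, ← hN', hN'', Matrix.det_updateCol_smul, ← mul_assoc, ← sq]
  exact dvd_mul_right _ _

/-- If `x` is a nonzero vector in the kernel of the symmetric matrix `A - μ B` which is isotropic
for `B`, then `μ` is at least a double root of `det (A - X B)`. -/
theorem sq_X_sub_C_dvd_det_pencil {K ι : Type*} [Field K] [Fintype ι] [DecidableEq ι]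
    (A B : Matrix ι ι K) (hA : Aᵀ = A) (hB : Bᵀ = B) (μ : K) (x : ι → K) (hx : x ≠ 0)
    (hAx : A *ᵥ x = μ • B *ᵥ x) (hxB : x ⬝ᵥ B *ᵥ x = 0) :
    (Polynomial.X - Polynomial.C μ) ^ 2 ∣ (A.map Polynomial.C -
      (Polynomial.X : Polynomial K) • B.map Polynomial.C).det := by
  obtain ⟨k, hk⟩ := Function.ne_iff.mp hx
  set P : Matrix ι ι K := (1 : Matrix ι ι K).updateCol k x with hP
  have hPdet : P.det = x k := by
    rw [hP, ← Matrix.cramer_apply, Matrix.cramer_one, Module.End.one_apply]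
  have hcol (S : Matrix ι ι K) (i : ι) : (Pᵀ * S * P) i k = P.col i ⬝ᵥ S *ᵥ x := by
    have hPk : P *ᵥ Pi.single k 1 = x := by
      ext i; simp [hP]
    rw [← Matrix.col_apply (Pᵀ * S * P), ← Matrix.mulVec_single_one, ← Matrix.mulVec_mulVec,
      hPk, ← Matrix.mulVec_mulVec]
    rfl
  have hsymm (S : Matrix ι ι K) (hS : Sᵀ = S) (i j : ι) :
      (Pᵀ * S * P) i j = (Pᵀ * S * P) j i := by
    have hT : (Pᵀ * S * P)ᵀ = Pᵀ * S * P := by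
      rw [Matrix.transpose_mul, Matrix.transpose_mul, Matrix.transpose_transpose, hS,
        Matrix.mul_assoc]
    exact congrFun₂ hT j i
  have hPk : P.col k = x := by
    ext i; simp [hP]
  have hcolA (i : ι) : (Pᵀ * A * P) i k = μ * (Pᵀ * B * P) i k := by
    rw [hcol, hcol, hAx, dotProduct_smul, smul_eq_mul]
  have hBkk : (Pᵀ * B * P) k k = 0 := by
    rw [hcol, hPk, hxB]
  set Q := P.map (Polynomial.C : K →+* Polynomial K) with hQ
  set N := A.map (Polynomial.C : K →+* Polynomial K) -
    (Polynomial.X : Polynomial K) • B.map (Polynomial.C : K →+* Polynomial K) with hN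
  have hQN : Qᵀ * N * Q = (Pᵀ * A * P).map (Polynomial.C : K →+* Polynomial K) -
      (Polynomial.X : Polynomial K) • (Pᵀ * B * P).map (Polynomial.C : K →+* Polynomial K) := by
    simp only [Matrix.map_mul, hQ, hN, Matrix.mul_sub, Matrix.sub_mul, Matrix.mul_smul,
      Matrix.smul_mul, Matrix.transpose_map]
  have hdvd (i : ι) : Polynomial.X - Polynomial.C μ ∣ (Qᵀ * N * Q) i k := by
    refine ⟨-Polynomial.C ((Pᵀ * B * P) i k), ?_⟩
    rw [hQN, Matrix.sub_apply, Matrix.smul_apply, Matrix.map_apply, Matrix.map_apply, hcolA,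
      map_mul, smul_eq_mul]
    ring
  have hdet := sq_dvd_det_of_dvd_row_col (Qᵀ * N * Q) (Polynomial.X - Polynomial.C μ) k
    (by rw [hQN, Matrix.sub_apply, Matrix.smul_apply, Matrix.map_apply, Matrix.map_apply, hcolA,
      hBkk]; simp)
    (fun j => by
      have h := hdvd j
      rw [hQN, Matrix.sub_apply, Matrix.smul_apply, Matrix.map_apply, Matrix.map_apply] at h ⊢
      rwa [hsymm A hA k j, hsymm B hB k j])
    hdvd
  have hQdet : IsUnit Q.det := by
    rw [hQ, ← RingHom.mapMatrix_apply, ← RingHom.map_det, hPdet]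
    exact (IsUnit.mk0 _ hk).map Polynomial.C
  rwa [Matrix.det_mul, Matrix.det_mul, Matrix.det_transpose, hQdet.dvd_mul_right,
    hQdet.dvd_mul_left] at hdet

/-- Let `n ≥ 1` and let `A` and `B` be invertible symmetric `n×n` complex
matrices such that all roots of the characteristic equation `det(A − λB) = 0` are pairwise
distinct. Then the projective quadrics `{x : xᵀAx = 0}` and `{x : xᵀBx = 0}` are transversal:
for every nonzero `x ∈ ℂⁿ` with `xᵀAx = 0` and `xᵀBx = 0`, the gradients `Ax` and `Bx` are
linearly independent over `ℂ`. -/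
theorem quadrics_transversal_of_distinct_roots (n : ℕ) (hn : 1 ≤ n)
    (A B : Matrix (Fin n) (Fin n) ℂ)
    (hA : A.transpose = A) (hB : B.transpose = B)
    (hAinv : IsUnit A.det) (hBinv : IsUnit B.det)
    (hroots : (Matrix.det (A.map Polynomial.C -
      (Polynomial.X : Polynomial ℂ) • B.map Polynomial.C)).roots.Nodup)
    (x : Fin n → ℂ) (hx : x ≠ 0)
    (hxA : x ⬝ᵥ A.mulVec x = 0) (hxB : x ⬝ᵥ B.mulVec x = 0) :
    LinearIndependent ℂ ![A.mulVec x, B.mulVec x] := by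
  have hBx : B *ᵥ x ≠ 0 := fun h =>
    hx (Matrix.eq_zero_of_mulVec_eq_zero hBinv.ne_zero h)
  rw [LinearIndependent.pair_symm_iff, LinearIndependent.pair_iff' hBx]
  intro μ hμ
  have hdvd := sq_X_sub_C_dvd_det_pencil A B hA hB μ x hx hμ.symm hxB
  set p := (A.map Polynomial.C - (Polynomial.X : Polynomial ℂ) • B.map Polynomial.C).det with hp
  have hp0 : p ≠ 0 := by
    intro h
    have h0 : p.eval 0 = A.det := by
      rw [hp, ← Polynomial.coe_evalRingHom, RingHom.map_det]
      congr 1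
      ext i j
      simp
    rw [h, Polynomial.eval_zero] at h0
    exact hAinv.ne_zero h0.symm
  have hle : 2 ≤ p.roots.count μ := by
    rw [Polynomial.count_roots]
    exact (Polynomial.le_rootMultiplicity_iff hp0).mpr hdvd
  have := Multiset.nodup_iff_count_le_one.mp hroots μ
  omega
end

section
/- Let g be an invertible n×n complex matrix such that all roots of the characteristic equation det(g gᵀ − λ·I) = 0 are pairwise distinct. Then for every nonzero x ∈ ℂⁿ with xᵀx = 0 and xᵀ(g gᵀ)x = 0, the vectors x and (g gᵀ)x are linearly independent over ℂ; that is, the quadrics Q(x) = 0 and Q(x g) = 0 are transversal, where Q(x) = ∑ⱼ xⱼ². -/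
open Matrix

/-- Over an algebraically closed field, a symmetric matrix whose characteristic polynomial has
distinct roots has no isotropic eigenvector. -/
theorem Matrix.IsSymm.dotProduct_self_ne_zero_of_mulVec_eq_smul {K ι : Type*} [Field K]
    [IsAlgClosed K] [Fintype ι] [DecidableEq ι] {S : Matrix ι ι K} (hS : S.IsSymm)
    (hroots : S.charpoly.roots.Nodup) {x : ι → K} (hx : x ≠ 0) {c : K}
    (hc : S *ᵥ x = c • x) : x ⬝ᵥ x ≠ 0 := by
  classical
  intro hxx
  have key : ∀ μ : S.charpoly.roots.toFinset, ∃ v : ι → K,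
      Module.End.HasEigenvector (Matrix.toLin' S) μ v ∧ x ⬝ᵥ v = 0 := by
    rintro ⟨μ, hμ⟩
    by_cases h : μ = c
    · exact ⟨x, ⟨Module.End.mem_eigenspace_iff.2 (by simpa [h] using hc), hx⟩, hxx⟩
    · have hev : Module.End.HasEigenvalue (Matrix.toLin' S) μ := by
        rw [Module.End.hasEigenvalue_iff_isRoot_charpoly, Matrix.charpoly_toLin']
        exact Polynomial.isRoot_of_mem_roots (Multiset.mem_toFinset.1 hμ)
      obtain ⟨v, hv⟩ := hev.exists_hasEigenvector
      refine ⟨v, hv, ?_⟩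
      have hSv : S *ᵥ v = μ • v := by simpa using hv.apply_eq_smul
      have e : x ⬝ᵥ S *ᵥ v = S *ᵥ x ⬝ᵥ v := by
        rw [dotProduct_mulVec, ← mulVec_transpose, hS.eq]
      rw [hSv, hc, dotProduct_smul, smul_dotProduct, smul_eq_mul, smul_eq_mul] at e
      exact (mul_eq_mul_right_iff.1 e).resolve_left h
  choose v hv hxv using key
  have hli : LinearIndependent K v :=
    Module.End.eigenvectors_linearIndependent' (Matrix.toLin' S) (fun μ : S.charpoly.roots.toFinset => (μ : K))
      Subtype.val_injective v hv
  have hcard : Fintype.card S.charpoly.roots.toFinset = Module.finrank K (ι → K) := by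
    rw [Fintype.card_coe, Multiset.toFinset_card_of_nodup hroots,
      ← (IsAlgClosed.splits S.charpoly).natDegree_eq_card_roots,
      Matrix.charpoly_natDegree_eq_dim, Module.finrank_fintype_fun_eq_card]
  have hspan := hli.span_eq_top_of_card_eq_finrank' hcard
  refine hx (dotProduct_eq_zero x fun w => ?_)
  have hw : w ∈ Submodule.span K (Set.range v) := hspan ▸ Submodule.mem_top
  induction hw using Submodule.span_induction with
  | mem _ h => obtain ⟨μ, rfl⟩ := h; exact hxv μ
  | zero => exact dotProduct_zero x
  | add _ _ _ _ ha hb => rw [dotProduct_add, ha, hb, add_zero]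
  | smul a _ _ h => rw [dotProduct_smul, h, smul_zero]

/-- Let `g` be an invertible `n×n` complex matrix such that all roots of
`det(g gᵀ − λ·I) = 0` are pairwise distinct. Then for every nonzero `x ∈ ℂⁿ` with
`xᵀx = 0` and `xᵀ(g gᵀ)x = 0`, the vectors `x` and `(g gᵀ)x` are linearly independent
over `ℂ`; i.e. the quadrics `Q(x) = 0` and `Q(xg) = 0` are transversal. -/
theorem quadric_and_shifted_quadric_transversal (n : ℕ)
    (g : Matrix (Fin n) (Fin n) ℂ) (hg : IsUnit g.det)
    (hroots : (Matrix.charpoly (g * g.transpose)).roots.Nodup)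
    (x : Fin n → ℂ) (hx : x ≠ 0)
    (h1 : x ⬝ᵥ x = 0) (h2 : x ⬝ᵥ (g * g.transpose).mulVec x = 0) :
    LinearIndependent ℂ ![x, (g * g.transpose).mulVec x] := by
  rw [LinearIndependent.pair_iff' hx]
  intro c hc
  exact (Matrix.isSymm_mul_transpose_self g).dotProduct_self_ne_zero_of_mulVec_eq_smul
    hroots hx hc.symm h1
end

section
/- Let A and B be symmetric n×n complex matrices with B invertible, and assume the polynomial equation det(A − λB) = 0 has n pairwise distinct roots λ₁, …, λₙ. Then there exists an invertible n×n complex matrix S such that SᵀBS is the identity matrix and SᵀAS is the diagonal matrix with diagonal entries λ₁, …, λₙ. -/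
open Matrix in
/-- A matrix commuting with a diagonal matrix with pairwise distinct entries is diagonal. -/
theorem Matrix.eq_diagonal_diag_of_commute_diagonal {ι K : Type*} [Fintype ι] [DecidableEq ι]
    [Field K] {M : Matrix ι ι K} {l : ι → K} (hl : Function.Injective l)
    (h : M * diagonal l = diagonal l * M) : M = diagonal M.diag := by
  ext i j
  rcases eq_or_ne i j with rfl | hij
  · simp
  · have hcomm := congrFun (congrFun h i) j
    rw [mul_diagonal, diagonal_mul] at hcomm
    have hzero : M i j * (l j - l i) = 0 := by linear_combination hcomm
    rw [diagonal_apply_ne _ hij]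
    exact (mul_eq_zero.mp hzero).resolve_right (sub_ne_zero.mpr (hl.ne hij.symm))

open Matrix in
/-- A pencil `A - x • B` with `B` invertible which is singular at pairwise distinct points `l i`
admits an invertible matrix of generalized eigenvectors. -/
theorem Matrix.exists_isUnit_mul_eq_mul_mul_diagonal {ι K : Type*} [Fintype ι] [DecidableEq ι]
    [Field K] {A B : Matrix ι ι K} (hB : IsUnit B.det) {l : ι → K} (hl : Function.Injective l)
    (h : ∀ i, (A - l i • B).det = 0) :
    ∃ V : Matrix ι ι K, IsUnit V ∧ A * V = B * V * diagonal l := by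
  choose v hv0 hv using fun i => exists_mulVec_eq_zero_iff.mpr (h i)
  have hAv (i : ι) : A *ᵥ v i = l i • B *ᵥ v i := by
    simpa [sub_mulVec, smul_mulVec, sub_eq_zero] using hv i
  refine ⟨(of v)ᵀ, ?_, ?_⟩
  · rw [← linearIndependent_cols_iff_isUnit]
    refine Module.End.eigenvectors_linearIndependent' (toLin' (B⁻¹ * A)) l hl v fun i => ?_
    refine ⟨Module.End.mem_eigenspace_iff.mpr ?_, hv0 i⟩
    rw [toLin'_apply, ← mulVec_mulVec, hAv, mulVec_smul, mulVec_mulVec, nonsing_inv_mul B hB,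
      one_mulVec]
  · ext i j
    rw [mul_diagonal, mul_comm]
    exact congrFun (hAv j) i

/-- The polynomial `det (A - X • B)` evaluates at `x` to `det (A - x • B)`. -/
theorem Matrix.eval_det_map_C_sub_X_smul {ι R : Type*} [Fintype ι] [DecidableEq ι] [CommRing R]
    (A B : Matrix ι ι R) (x : R) :
    (Matrix.det (A.map Polynomial.C - (Polynomial.X : Polynomial R) • B.map Polynomial.C)).eval x =
      (A - x • B).det := by
  rw [← Polynomial.coe_evalRingHom, RingHom.map_det]
  congr 1
  ext i j
  simp [mul_comm x]


/-- Weierstrass theorem: Let `A`, `B` be symmetric `n×n` complex matrices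
with `B` invertible, and assume `det(A − λB) = 0` has `n` pairwise distinct roots
`λ₁, …, λₙ`. Then there exists an invertible `S` with `SᵀBS = 1` and
`SᵀAS = diag(λ₁, …, λₙ)`. -/
theorem weierstrass_simultaneous_reduction (n : ℕ)
    (A B : Matrix (Fin n) (Fin n) ℂ)
    (hA : A.transpose = A) (hB : B.transpose = B) (hBinv : IsUnit B.det)
    (l : Fin n → ℂ) (hl : Function.Injective l)
    (hroots : (Matrix.det (A.map Polynomial.C -
      (Polynomial.X : Polynomial ℂ) • B.map Polynomial.C)).roots =
      Finset.univ.val.map l) :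
    ∃ S : Matrix (Fin n) (Fin n) ℂ, IsUnit S.det ∧
      S.transpose * B * S = 1 ∧ S.transpose * A * S = Matrix.diagonal l := by
  have hsing (i : Fin n) : (A - l i • B).det = 0 := by
    rw [← Matrix.eval_det_map_C_sub_X_smul]
    refine (Polynomial.mem_roots'.mp ?_).2
    rw [hroots]
    exact Multiset.mem_map_of_mem l (Finset.mem_univ i)
  obtain ⟨V, hV, hAV⟩ := Matrix.exists_isUnit_mul_eq_mul_mul_diagonal hBinv hl hsing
  have hVdet := (Matrix.isUnit_iff_isUnit_det V).mp hV
  obtain ⟨M, hM⟩ : ∃ M, M = V.transpose * B * V := ⟨_, rfl⟩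
  have hVAV : V.transpose * A * V = M * Matrix.diagonal l := by
    rw [Matrix.mul_assoc, hAV, hM]
    simp only [Matrix.mul_assoc]
  have hMsymm : M.transpose = M := by
    simp [hM, Matrix.transpose_mul, hB, Matrix.mul_assoc]
  have hcomm : M * Matrix.diagonal l = Matrix.diagonal l * M := by
    have h := congrArg Matrix.transpose hVAV
    simp only [Matrix.transpose_mul, Matrix.transpose_transpose, hA, hMsymm,
      Matrix.diagonal_transpose] at h
    rw [← h, ← hVAV, Matrix.mul_assoc]
  have hdiag := Matrix.eq_diagonal_diag_of_commute_diagonal hl hcomm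
  have hMdet : M.det ≠ 0 := by
    rw [hM, Matrix.det_mul, Matrix.det_mul, Matrix.det_transpose]
    exact ((hVdet.mul hBinv).mul hVdet).ne_zero
  have hM0 (i : Fin n) : M.diag i ≠ 0 := by
    rw [hdiag, Matrix.det_diagonal] at hMdet
    exact Finset.prod_ne_zero_iff.mp hMdet i (Finset.mem_univ i)
  choose r hr using fun i => IsAlgClosed.exists_eq_mul_self (M.diag i)
  have hr0 (i : Fin n) : r i ≠ 0 := fun h => hM0 i (by rw [hr, h, mul_zero])
  have hcongr (X : Matrix (Fin n) (Fin n) ℂ) :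
      (V * Matrix.diagonal r⁻¹).transpose * X * (V * Matrix.diagonal r⁻¹) =
        Matrix.diagonal r⁻¹ * (V.transpose * X * V) * Matrix.diagonal r⁻¹ := by
    simp only [Matrix.transpose_mul, Matrix.diagonal_transpose, Matrix.mul_assoc]
  refine ⟨V * Matrix.diagonal r⁻¹, ?_, ?_, ?_⟩
  · rw [Matrix.det_mul, Matrix.det_diagonal]
    refine hVdet.mul (Finset.prod_ne_zero_iff.mpr fun i _ => inv_ne_zero (hr0 i)).isUnit
  · rw [hcongr, ← hM, hdiag, Matrix.diagonal_mul_diagonal, Matrix.diagonal_mul_diagonal,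
      ← Matrix.diagonal_one]
    congr 1
    ext i
    have := hr0 i
    simp only [Pi.inv_apply, hr]
    field_simp
  · rw [hcongr, hVAV, hdiag, Matrix.diagonal_mul_diagonal, Matrix.diagonal_mul_diagonal,
      Matrix.diagonal_mul_diagonal]
    congr 1
    ext i
    have := hr0 i
    simp only [Pi.inv_apply, hr]
    field_simp
end
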